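/- Let G be a countable group, M ⊆ G a finite subset, A a finite set, and S = A^(A^M). If σ_s is stably injective for some s ∈ S^G, then σ_s is stably reversible: there exist a finite subset N ⊆ G and q ∈ T^G, where T = A^(A^N), such that for every p ∈ Σ(s) there exists w ∈ Σ(q) with σ_w ∘ σ_p = Id. -/

import Mathlib

open Pointwise

section ANUCA

variable {G : Type*} [Group G] {A : Type*}

/-- The shift action of `G` on configurations: `(g · x) h = x (g⁻¹ * h)`. -/
def shiftC {S : Type*} (g : G) (x : G → S) : G → S := fun h => x (g⁻¹ * h)

/-- The prodiscrete topology on `G → S` (product topology, `S` discrete). -/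
def prodiscrete (G S : Type*) : TopologicalSpace (G → S) :=
  @Pi.topologicalSpace G (fun _ => S) (fun _ => ⊥)

/-- `Σ(s)`: the closure of the shift orbit of `s` in the prodiscrete topology. -/
def orbitClosure {S : Type*} (s : G → S) : Set (G → S) :=
  @closure _ (prodiscrete G S) {p | ∃ g : G, shiftC g s = p}

/-- The ANUCA `σ_s` with memory `M` associated with the configuration of local
defining maps `s : G → (A^M → A)`, namely `σ_s x g = s g ((g⁻¹ · x)|_M)`. -/
def anuca (M : Set G) (s : G → ((M → A) → A)) (x : G → A) : G → A :=
  fun g => s g (fun m => x (g * (m : G)))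

/-- `σ_s` is stably injective if `σ_p` is injective for every `p ∈ Σ(s)`. -/
def StablyInjective (M : Set G) (s : G → ((M → A) → A)) : Prop :=
  ∀ p ∈ orbitClosure s, Function.Injective (anuca M p)

/-- `σ_s` is reversible if `σ_w ∘ σ_s = Id` for some ANUCA `σ_w` with finite memory. -/
def Reversible (M : Set G) (s : G → ((M → A) → A)) : Prop :=
  ∃ N : Set G, N.Finite ∧ ∃ w : G → ((N → A) → A), anuca N w ∘ anuca M s = id

/-- `σ_s` is stably reversible if there are a finite `N ⊆ G` and `q ∈ T^G`,
`T = A^(A^N)`, such that every `p ∈ Σ(s)` admits `w ∈ Σ(q)` with `σ_w ∘ σ_p = Id`. -/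
def StablyReversible (M : Set G) (s : G → ((M → A) → A)) : Prop :=
  ∃ N : Set G, N.Finite ∧ ∃ q : G → ((N → A) → A),
    ∀ p ∈ orbitClosure s, ∃ w ∈ orbitClosure q, anuca N w ∘ anuca M p = id

/-- `σ_s` is invertible if it is bijective and its inverse is an ANUCA with finite memory. -/
def InvertibleANUCA (M : Set G) (s : G → ((M → A) → A)) : Prop :=
  Function.Bijective (anuca M s) ∧
    ∃ N : Set G, N.Finite ∧ ∃ w : G → ((N → A) → A),
      anuca N w ∘ anuca M s = id ∧ anuca M s ∘ anuca N w = id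

/-- Two configurations are asymptotic if they agree outside a finite set. -/
def Asymptotic {S : Type*} (x y : G → S) : Prop := {g : G | x g ≠ y g}.Finite

/-- A map `τ : A^G → A^G` is pre-injective if it is injective on asymptotic pairs. -/
def PreInjective (τ : (G → A) → (G → A)) : Prop :=
  ∀ x y : G → A, Asymptotic x y → τ x = τ y → x = y

/-- A map `τ : A^G → A^G` is post-surjective if every configuration asymptotic to
`τ x` is the image of a configuration asymptotic to `x`. -/
def PostSurjective (τ : (G → A) → (G → A)) : Prop :=
  ∀ x y : G → A, Asymptotic y (τ x) → ∃ z : G → A, Asymptotic z x ∧ τ z = y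

end ANUCA

section Helpers

variable {G : Type*} [Group G] {A : Type*}

theorem orbitClosure_eq_closure_range {S : Type*} [t : TopologicalSpace S] [DiscreteTopology S]
    (s : G → S) : orbitClosure s = closure (Set.range fun g : G => shiftC g s) := by
  have ht : t = ⊥ := DiscreteTopology.eq_bot
  subst ht
  rfl

theorem shiftC_inv_shiftC {S : Type*} (g : G) (x : G → S) : shiftC g (shiftC g⁻¹ x) = x := by
  funext h
  simp [shiftC]

theorem anuca_shiftC (M : Set G) (s : G → ((M → A) → A)) (g : G) (x : G → A) :
    anuca M (shiftC g s) (shiftC g x) = shiftC g (anuca M s x) := by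
  funext h
  simp [anuca, shiftC, mul_assoc]

theorem anuca_comp_shiftC {M N : Set G} {s : G → ((M → A) → A)} {q : G → ((N → A) → A)}
    (hq : anuca N q ∘ anuca M s = id) (g : G) :
    anuca N (shiftC g q) ∘ anuca M (shiftC g s) = id := by
  funext x
  have hx := congrFun hq (shiftC g⁻¹ x)
  simp only [Function.comp_apply, id] at hx ⊢
  rw [← shiftC_inv_shiftC g x, anuca_shiftC, anuca_shiftC, hx]

theorem continuous_anuca [TopologicalSpace A] [DiscreteTopology A] [Finite A]
    {M : Set G} (hM : M.Finite) :
    Continuous fun px : (G → ((M → A) → A)) × (G → A) => anuca M px.1 px.2 := by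
  have : Finite M := hM
  refine continuous_pi fun g => ?_
  have hev : Continuous fun fz : ((M → A) → A) × (M → A) => fz.1 fz.2 :=
    continuous_of_discreteTopology
  have hloc : Continuous fun px : (G → ((M → A) → A)) × (G → A) =>
      (px.1 g, fun m : M => px.2 (g * (m : G))) := by fun_prop
  exact hev.comp hloc

/-- By compactness, a stably injective ANUCA has a finite window `N` such that, for every
`p ∈ Σ(s)`, the restriction of `σ_p x` to `N` determines `x 1`. -/
theorem StablyInjective.exists_finset_window [Finite A] {M : Set G} (hM : M.Finite)
    {s : G → ((M → A) → A)} (h : StablyInjective M s) :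
    ∃ N : Finset G, ∀ p ∈ orbitClosure s, ∀ x y : G → A,
      (∀ n ∈ N, anuca M p x n = anuca M p y n) → x 1 = y 1 := by
  let _ : TopologicalSpace A := ⊥
  have _ : DiscreteTopology A := ⟨rfl⟩
  have : Finite M := hM
  have hc : IsClosed (orbitClosure s) := by
    rw [orbitClosure_eq_closure_range]
    exact isClosed_closure
  let X := (G → ((M → A) → A)) × (G → A) × (G → A)
  have hK : IsCompact {t : X | t.1 ∈ orbitClosure s ∧ t.2.1 1 ≠ t.2.2 1} := by
    refine IsClosed.isCompact ?_
    have hdiff : IsClosed {t : X | t.2.1 1 ≠ t.2.2 1} :=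
      (isClosed_discrete {ab : A × A | ab.1 ≠ ab.2}).preimage
        (by fun_prop : Continuous fun t : X => (t.2.1 1, t.2.2 1))
    exact (hc.preimage continuous_fst).inter hdiff
  have hleft : Continuous fun t : X => anuca M t.1 t.2.1 :=
    (continuous_anuca hM).comp (by fun_prop : Continuous fun t : X => (t.1, t.2.1))
  have hright : Continuous fun t : X => anuca M t.1 t.2.2 :=
    (continuous_anuca hM).comp (by fun_prop : Continuous fun t : X => (t.1, t.2.2))
  obtain ⟨N, hN⟩ := hK.elim_finite_subfamily_closed
    (fun g : G => {t : X | anuca M t.1 t.2.1 g = anuca M t.1 t.2.2 g})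
    (fun g => isClosed_eq ((continuous_apply g).comp hleft) ((continuous_apply g).comp hright))
    (by
      rw [Set.eq_empty_iff_forall_notMem]
      rintro ⟨p, x, y⟩ ⟨⟨hp, hne⟩, heq⟩
      refine hne (congrFun (h p hp (funext fun g => ?_)) 1)
      exact Set.mem_iInter.1 heq g)
  refine ⟨N, fun p hp x y hxy => ?_⟩
  by_contra hne
  exact Set.eq_empty_iff_forall_notMem.1 hN (p, x, y) ⟨⟨hp, hne⟩, Set.mem_iInter₂.2 hxy⟩

theorem StablyInjective.reversible [Finite A] {M : Set G} (hM : M.Finite)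
    {s : G → ((M → A) → A)} (h : StablyInjective M s) : Reversible M s := by
  classical
  obtain ⟨N, hN⟩ := h.exists_finset_window hM
  have hshift : ∀ g : G, shiftC g s ∈ orbitClosure s := fun g =>
    @subset_closure _ (prodiscrete G _) _ _ ⟨g, rfl⟩
  have key : ∀ (g : G) (x y : G → A),
      (∀ n ∈ N, anuca M s x (g * n) = anuca M s y (g * n)) → x g = y g := by
    intro g x y hxy
    have := hN _ (hshift g⁻¹) (shiftC g⁻¹ x) (shiftC g⁻¹ y) fun n hn => by
      simpa [anuca_shiftC, shiftC] using hxy n hn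
    simpa [shiftC] using this
  let N' : Set G := insert 1 (N : Set G)
  let q : G → ((N' → A) → A) := fun g z =>
    if hz : ∃ x : G → A, ∀ n : N', anuca M s x (g * n) = z n then hz.choose g
    else z ⟨1, Set.mem_insert _ _⟩
  refine ⟨N', N.finite_toSet.insert 1, q, ?_⟩
  funext x g
  have hz : ∃ y : G → A, ∀ n : N', anuca M s y (g * n) = anuca M s x (g * n) :=
    ⟨x, fun _ => rfl⟩
  change q g (fun n => anuca M s x (g * n)) = x g
  simp only [q, dif_pos hz]
  exact key g _ _ fun n hn => hz.choose_spec ⟨n, Set.mem_insert_of_mem _ hn⟩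

/-- A left inverse with finite memory of `σ_s` yields left inverses along all of `Σ(s)`. -/
theorem Reversible.stablyReversible [Finite A] {M : Set G} (hM : M.Finite)
    {s : G → ((M → A) → A)} (h : Reversible M s) : StablyReversible M s := by
  obtain ⟨N, hNfin, q, hq⟩ := h
  refine ⟨N, hNfin, q, fun p hp => ?_⟩
  let _ : TopologicalSpace A := ⊥
  have _ : DiscreteTopology A := ⟨rfl⟩
  have : Finite M := hM
  have : Finite N := hNfin
  rw [orbitClosure_eq_closure_range] at hp ⊢
  let P := (G → ((M → A) → A)) × (G → ((N → A) → A))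
  let O : Set P := Set.range fun g : G => (shiftC g s, shiftC g q)
  have hclosed : IsClosed {t : P | anuca N t.2 ∘ anuca M t.1 = id} := by
    have : {t : P | anuca N t.2 ∘ anuca M t.1 = id} =
        ⋂ x : G → A, {t : P | anuca N t.2 (anuca M t.1 x) = x} := by
      ext t
      simp [funext_iff]
    rw [this]
    refine isClosed_iInter fun x => isClosed_eq ?_ continuous_const
    have hinner : Continuous fun t : P => anuca M t.1 x :=
      (continuous_anuca hM).comp (by fun_prop : Continuous fun t : P => (t.1, x))
    exact (continuous_anuca hNfin).comp (continuous_snd.prodMk hinner)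
  have hproj : closure (Set.range fun g : G => shiftC g s) ⊆ Prod.fst '' closure O := by
    refine closure_minimal ?_ (isClosed_closure.isCompact.image continuous_fst).isClosed
    rintro _ ⟨g, rfl⟩
    exact ⟨_, subset_closure ⟨g, rfl⟩, rfl⟩
  obtain ⟨⟨p', w⟩, hw, rfl⟩ := hproj hp
  refine ⟨w, ?_, ?_⟩
  · refine map_mem_closure continuous_snd hw ?_
    rintro _ ⟨g, rfl⟩
    exact ⟨g, rfl⟩
  · refine closure_minimal ?_ hclosed hw
    rintro _ ⟨g, rfl⟩
    exact anuca_comp_shiftC hq g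

end Helpers

/-- Over a countable group and finite alphabet, every stably injective ANUCA with finite
memory is stably reversible. -/
theorem stmt15 {G A : Type*} [Group G] [Countable G] [Finite A]
    (M : Set G) (hM : M.Finite) (s : G → ((M → A) → A))
    (h : StablyInjective M s) :
    StablyReversible M s :=
  (h.reversible hM).stablyReversible hM
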